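/- arXiv:0807.4808 — 3 statements merged into one kernel-verified Lean document; each statement's English description precedes it below -/
import Mathlib

section
/- There exists ε > 0 such that for all real x with |x| < ε, F(7/24, -1/24; 3/4; 108·x·(x-1)^4 / (x^2+14x+1)^3) = (1+14x+x^2)^(-1/8). -/
open Real

/-- The Gauss hypergeometric series `F(a,b;c;z) = ∑ ((a)_n (b)_n / ((c)_n n!)) z^n`,
where `(q)_n` is the rising (Pochhammer) factorial. -/
noncomputable def hypgeo (a b c z : ℝ) : ℝ :=
  ∑' n : ℕ, ((∏ i ∈ Finset.range n, (a + i)) * (∏ i ∈ Finset.range n, (b + i)) /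
    ((∏ i ∈ Finset.range n, (c + i)) * (Nat.factorial n))) * z ^ n

open Filter Topology

/-- The derivative of a one-variable power series is given by the termwise derivative. -/
theorem HasFPowerSeriesOnBall.exists_deriv {f : ℝ → ℝ} {p : FormalMultilinearSeries ℝ ℝ ℝ}
    {x : ℝ} {r : ENNReal} (h : HasFPowerSeriesOnBall f p x r) :
    ∃ q : FormalMultilinearSeries ℝ ℝ ℝ, HasFPowerSeriesOnBall (deriv f) q x r ∧
      ∀ n, q.coeff n = (n + 1) * p.coeff (n + 1) := by
  refine ⟨_, (ContinuousLinearMap.apply ℝ ℝ (1 : ℝ)).comp_hasFPowerSeriesOnBall h.fderiv,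
    fun n => ?_⟩
  have := p.derivSeries_coeff_one n
  rw [nsmul_eq_mul] at this
  exact_mod_cast this

theorem ascPochhammer_eval_eq_prod (n : ℕ) (a : ℝ) :
    (ascPochhammer ℝ n).eval a = ∏ i ∈ Finset.range n, (a + i) := by
  induction n with
  | zero => simp
  | succ n ih => rw [ascPochhammer_succ_eval, Finset.prod_range_succ, ih]

theorem hypgeo_eq_ordinaryHypergeometric (a b c : ℝ) :
    hypgeo a b c = ordinaryHypergeometric a b c := by
  funext z
  rw [ordinaryHypergeometric_eq_tsum]
  refine tsum_congr fun n => ?_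
  simp only [ascPochhammer_eval_eq_prod, smul_eq_mul]
  rw [div_eq_mul_inv, mul_inv]
  ring

theorem hasFPowerSeriesOnBall_hypgeo {a b c : ℝ}
    (habc : ∀ k : ℕ, (k : ℝ) ≠ -a ∧ (k : ℝ) ≠ -b ∧ (k : ℝ) ≠ -c) :
    HasFPowerSeriesOnBall (hypgeo a b c) (ordinaryHypergeometricSeries ℝ a b c) 0 1 := by
  have h := ordinaryHypergeometricSeries_radius_eq_one ℝ a b c habc
  rw [hypgeo_eq_ordinaryHypergeometric, ← h]
  exact FormalMultilinearSeries.hasFPowerSeriesOnBall _ (by simp [h])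

/-- The hypergeometric differential equation on the unit interval. -/
theorem hypgeo_ode {a b c z : ℝ}
    (habc : ∀ k : ℕ, (k : ℝ) ≠ -a ∧ (k : ℝ) ≠ -b ∧ (k : ℝ) ≠ -c) (hz : |z| < 1) :
    z * (1 - z) * deriv (deriv (hypgeo a b c)) z +
      (c - (a + b + 1) * z) * deriv (hypgeo a b c) z - a * b * hypgeo a b c z = 0 := by
  have h0 := hasFPowerSeriesOnBall_hypgeo habc
  obtain ⟨q, h1, hq⟩ := h0.exists_deriv
  obtain ⟨s, h2, hs⟩ := h1.exists_deriv
  have hmem : z ∈ Metric.eball (0 : ℝ) 1 := by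
    rw [Metric.mem_eball, edist_zero_right, ← ofReal_norm, Real.norm_eq_abs]
    simpa using hz
  set u : ℕ → ℝ := (ordinaryHypergeometricSeries ℝ a b c).coeff with hu
  have hrec (n : ℕ) : (n + 1) * (n + c) * u (n + 1) = (n + a) * (n + b) * u n := by
    have hc (k : ℕ) : (ascPochhammer ℝ k).eval c ≠ 0 := by
      rw [ne_eq, ascPochhammer_eval_eq_zero_iff]
      rintro ⟨m, -, hm⟩
      exact (habc m).2.2 (by linarith)
    have hn := hc n
    have hn' := hc (n + 1)
    rw [ascPochhammer_succ_eval] at hn'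
    have hn'' : c + n ≠ 0 := right_ne_zero_of_mul hn'
    have : ((n : ℝ) + 1) ≠ 0 := by positivity
    have : (n.factorial : ℝ) ≠ 0 := by positivity
    simp only [hu, ordinaryHypergeometricSeries, FormalMultilinearSeries.coeff_ofScalars,
      ordinaryHypergeometricCoefficient, ascPochhammer_succ_eval, Nat.factorial_succ]
    push_cast
    field_simp
    ring
  have s0 := h0.hasSum hmem
  have s1 := h1.hasSum hmem
  have s2 := h2.hasSum hmem
  simp only [FormalMultilinearSeries.apply_eq_pow_smul_coeff, zero_add, smul_eq_mul, hs, hq,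
    ← hu] at s0 s1 s2
  have t1 : HasSum (fun n : ℕ => z ^ n * (n * u n)) (z * deriv (hypgeo a b c) z) := by
    rw [← hasSum_nat_add_iff' 1]
    simpa [pow_succ', mul_assoc] using s1.mul_left z
  have t2 : HasSum (fun n : ℕ => z ^ n * (n * ((n + 1) * u (n + 1))))
      (z * deriv (deriv (hypgeo a b c)) z) := by
    rw [← hasSum_nat_add_iff' 1]
    simpa [pow_succ', mul_assoc] using s2.mul_left z
  have t3 : HasSum (fun n : ℕ => z ^ n * (n * (n - 1) * u n))
      (z * (z * deriv (deriv (hypgeo a b c)) z)) := by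
    rw [← hasSum_nat_add_iff' 1]
    have := t2.mul_left z
    simp only [Finset.range_one, Finset.sum_singleton, Nat.cast_zero, zero_mul, mul_zero, sub_zero]
    refine this.congr_fun ?_
    intro n
    push_cast
    ring
  have key := ((t2.sub t3).add ((s1.mul_left c).sub (t1.mul_left (a + b + 1)))).sub
    (s0.mul_left (a * b))
  have hzero := key.unique (hasSum_zero.congr_fun fun n => by
    linear_combination z ^ n * hrec n)
  linear_combination hzero

/-- Uniqueness of the analytic solution vanishing at a regular singular point `0` whose second
exponent is not a positive integer. -/
theorem eventually_eq_zero_of_regular_singular_ode {G G₁ G₂ P Q R : ℝ → ℝ}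
    (hG : AnalyticAt ℝ G 0) (hG0 : G 0 = 0)
    (hG₁ : ∀ᶠ x in 𝓝 0, HasDerivAt G (G₁ x) x) (hG₂ : ∀ᶠ x in 𝓝 0, HasDerivAt G₁ (G₂ x) x)
    (hP : ContinuousAt P 0) (hQ : ContinuousAt Q 0) (hR : ContinuousAt R 0)
    (hPQ : ∀ m : ℕ, m * P 0 + Q 0 ≠ 0)
    (hode : ∀ᶠ x in 𝓝 0, x * P x * G₂ x + Q x * G₁ x + R x * G x = 0) :
    ∀ᶠ x in 𝓝 0, G x = 0 := by
  by_contra hne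
  obtain ⟨n, h, hh, hh0, hGh⟩ := hG.exists_eventuallyEq_pow_smul_nonzero_iff.mpr hne
  simp only [sub_zero, smul_eq_mul] at hGh
  obtain _ | m := n
  · have := hGh.self_of_nhds
    simp [hG0, hh0.symm] at this
  have hd1 : ∀ᶠ x in 𝓝 0, HasDerivAt h (deriv h x) x :=
    hh.eventually_analyticAt.mono fun x hx => hx.differentiableAt.hasDerivAt
  have hd2 : ∀ᶠ x in 𝓝 0, HasDerivAt (deriv h) (deriv (deriv h) x) x :=
    hh.deriv.eventually_analyticAt.mono fun x hx => hx.differentiableAt.hasDerivAt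
  have e1 : ∀ᶠ x in 𝓝 0, G₁ x = (m + 1) * x ^ m * h x + x ^ (m + 1) * deriv h x := by
    filter_upwards [hG₁, hd1, hGh.eventually_nhds] with x hx hx1 hx2
    have := ((hasDerivAt_pow (m + 1) x).mul hx1).congr_of_eventuallyEq hx2
    simpa using hx.unique this
  have e2 : ∀ᶠ x in 𝓝 0, x * G₂ x = (m + 1) * m * x ^ m * h x +
      x ^ (m + 1) * (2 * (m + 1) * deriv h x) + x ^ (m + 2) * deriv (deriv h) x := by
    filter_upwards [hG₂, hd1, hd2, e1.eventually_nhds] with x hx hx1 hx2 hx3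
    have := ((((hasDerivAt_pow m x).const_mul ((m : ℝ) + 1)).mul hx1).add
      ((hasDerivAt_pow (m + 1) x).mul hx2)).congr_of_eventuallyEq hx3
    rw [hx.unique this]
    have hpow : x * (m * x ^ (m - 1)) = m * x ^ m := by
      cases m
      · simp
      · simp only [Nat.add_sub_cancel, pow_succ]
        ring
    simp only [Nat.add_sub_cancel]
    push_cast
    linear_combination ((m : ℝ) + 1) * h x * hpow
  set W : ℝ → ℝ := fun x => (m + 1) * (m * P x + Q x) * h x +
    x * ((2 * (m + 1) * P x + Q x) * deriv h x + R x * h x) + x ^ 2 * P x * deriv (deriv h) x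
    with hW
  have hWc : ContinuousAt W 0 := by
    have c0 := hh.continuousAt
    have c1 := hh.deriv.continuousAt
    have c2 := hh.deriv.deriv.continuousAt
    fun_prop
  have hW0 : ∀ᶠ x in 𝓝[≠] 0, W x = 0 := by
    filter_upwards [nhdsWithin_le_nhds hode, nhdsWithin_le_nhds e1, nhdsWithin_le_nhds e2,
      nhdsWithin_le_nhds hGh, self_mem_nhdsWithin] with x h1 h2 h3 h4 h5
    have h5 : x ≠ 0 := h5
    refine (mul_eq_zero.mp (?_ : x ^ m * W x = 0)).resolve_left (pow_ne_zero _ h5)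
    rw [h2, h4] at h1
    linear_combination h1 - P x * h3
  have hlim : W 0 = 0 := tendsto_nhds_unique (hWc.tendsto.mono_left nhdsWithin_le_nhds)
    (tendsto_const_nhds.congr' (hW0.mono fun x hx => hx.symm))
  have hm : ((m : ℝ) + 1) ≠ 0 := by positivity
  simp [hW, hPQ, hh0, hm] at hlim

theorem stmt7 : ∃ ε > 0, ∀ x : ℝ, |x| < ε →
    hypgeo (7/24) (-1/24) (3/4) (108 * x * (x - 1)^4 / (x^2 + 14*x + 1)^3) =
      (1 + 14*x + x^2) ^ ((-1 : ℝ)/8) := by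
  have habc (k : ℕ) : (k : ℝ) ≠ -(7/24) ∧ (k : ℝ) ≠ -(-1/24) ∧ (k : ℝ) ≠ -(3/4) := by
    have hk : (0 : ℝ) ≤ k := k.cast_nonneg
    refine ⟨by linarith, fun h => ?_, by linarith⟩
    have h1 : ((24 * k : ℕ) : ℝ) = (1 : ℕ) := by
      push_cast
      linarith
    have h2 := Nat.cast_injective h1
    omega
  set F := hypgeo (7/24) (-1/24) (3/4) with hF
  have hFan := (hasFPowerSeriesOnBall_hypgeo habc).analyticOnNhd
  set D : ℝ → ℝ := fun x => x ^ 2 + 14 * x + 1 with hD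
  set Z : ℝ → ℝ := fun x => 108 * x * (x - 1) ^ 4 / D x ^ 3 with hZ
  set N : ℝ → ℝ := fun x => -108 * (x - 1) ^ 3 * (x + 1) * (x ^ 2 - 34 * x + 1) with hN
  set N' : ℝ → ℝ := fun x => -108 * (3 * (x - 1) ^ 2 * (x + 1) * (x ^ 2 - 34 * x + 1) +
    (x - 1) ^ 3 * (x ^ 2 - 34 * x + 1) + (x - 1) ^ 3 * (x + 1) * (2 * x - 34)) with hN'
  have hDd (x : ℝ) : HasDerivAt D (2 * x + 14) x := by
    have := ((hasDerivAt_pow 2 x).add ((hasDerivAt_id x).const_mul 14)).add_const 1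
    exact this.congr_deriv (by norm_num)
  have hNd (x : ℝ) : HasDerivAt N (N' x) x := by
    have h1 := ((((hasDerivAt_id x).sub_const 1).pow 3).const_mul (-108)).mul
      ((hasDerivAt_id x).add_const 1)
    have h2 := ((hasDerivAt_pow 2 x).sub ((hasDerivAt_id x).const_mul 34)).add_const 1
    refine (h1.mul h2).congr_deriv ?_
    simp [hN']
    ring
  have hZd (x : ℝ) (hx : 0 < D x) : HasDerivAt Z (N x / D x ^ 4) x := by
    have h1 := ((hasDerivAt_id x).const_mul 108).mul (((hasDerivAt_id x).sub_const 1).pow 4)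
    refine (h1.div ((hDd x).pow 3) (pow_ne_zero 3 hx.ne')).congr_deriv ?_
    simp [hN]
    field_simp
    simp only [hD]
    ring
  have hZdd (x : ℝ) (hx : 0 < D x) : HasDerivAt (fun x => N x / D x ^ 4)
      ((N' x * D x - 4 * N x * (2 * x + 14)) / D x ^ 5) x := by
    refine ((hNd x).div ((hDd x).pow 4) (pow_ne_zero 4 hx.ne')).congr_deriv ?_
    simp
    field_simp
  have hDc : Continuous D := by fun_prop
  have hDpos : ∀ᶠ x in 𝓝 0, 0 < D x :=
    hDc.continuousAt.eventually (lt_mem_nhds (by simp [hD]))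
  have hZan : AnalyticAt ℝ Z 0 := by
    have : D 0 ^ 3 ≠ 0 := by simp [hD]
    fun_prop (disch := assumption)
  have hZ0 : Z 0 = 0 := by simp [hZ]
  have hZlt : ∀ᶠ x in 𝓝 0, |Z x| < 1 :=
    hZan.continuousAt.abs.eventually (gt_mem_nhds (by simp [hZ0]))
  have hmem {z : ℝ} (hz : |z| < 1) : AnalyticAt ℝ F z := hFan z (by
    rw [Metric.mem_eball, edist_zero_right, ← ofReal_norm, Real.norm_eq_abs]
    simpa using hz)
  have key := eventually_eq_zero_of_regular_singular_ode
    (G := fun x => F (Z x) - D x ^ ((-1 : ℝ) / 8))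
    (G₁ := fun x => deriv F (Z x) * (N x / D x ^ 4) -
      (2 * x + 14) * ((-1 : ℝ) / 8) * D x ^ ((-1 : ℝ) / 8 - 1))
    (G₂ := fun x => (deriv (deriv F) (Z x) * (N x / D x ^ 4)) * (N x / D x ^ 4) +
      deriv F (Z x) * ((N' x * D x - 4 * N x * (2 * x + 14)) / D x ^ 5) -
      (2 * ((-1 : ℝ) / 8) * D x ^ ((-1 : ℝ) / 8 - 1) + (2 * x + 14) * ((-1 : ℝ) / 8) *
        ((2 * x + 14) * ((-1 : ℝ) / 8 - 1) * D x ^ ((-1 : ℝ) / 8 - 1 - 1))))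
    (P := fun x => D x ^ 2) (Q := fun x => 3 / 4 * D x ^ 2 + x * (x + 7) * D x / 2)
    (R := fun x => 21 / 16 * (x - 1) ^ 2)
    ?_ ?_ ?_ ?_ (by fun_prop) (by fun_prop) (by fun_prop) ?_ ?_
  · obtain ⟨ε, hε, h⟩ := Metric.eventually_nhds_iff.mp key
    refine ⟨ε, hε, fun x hx => ?_⟩
    have := h (y := x) (by simpa [Real.dist_eq] using hx)
    rw [show 1 + 14 * x + x ^ 2 = D x by simp only [hD]; ring]
    exact sub_eq_zero.mp this
  · have h1 : AnalyticAt ℝ F (Z 0) := hmem (by simp [hZ0])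
    have h2 : AnalyticAt ℝ D 0 := by fun_prop
    have h3 : AnalyticAt ℝ (fun x => D x ^ ((-1 : ℝ) / 8)) 0 :=
      ((h2.log hDpos.self_of_nhds).mul analyticAt_const).rexp'.congr
        (hDpos.mono fun x hx => (Real.rpow_def_of_pos hx _).symm)
    exact (h1.fun_comp hZan).sub h3
  · simp only [hZ0, hD]
    simp [hF, hypgeo_eq_ordinaryHypergeometric]
  · filter_upwards [hDpos, hZlt] with x hx hz
    exact ((hmem hz).differentiableAt.hasDerivAt.comp x (hZd x hx)).sub
      ((hDd x).rpow_const (Or.inl hx.ne'))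
  · filter_upwards [hDpos, hZlt] with x hx hz
    have h1 := ((hmem hz).deriv.differentiableAt.hasDerivAt.comp x (hZd x hx)).mul (hZdd x hx)
    have h2 := ((hasDerivAt_id x).const_mul 2).add_const 14
    have h3 := (h2.mul_const ((-1 : ℝ) / 8)).mul
      ((hDd x).rpow_const (p := (-1 : ℝ) / 8 - 1) (Or.inl hx.ne'))
    refine (h1.sub h3).congr_deriv ?_
    simp
  · intro m
    simp [hD]
    positivity
  · filter_upwards [hDpos, hZlt] with x hx hz
    have hode := hypgeo_ode habc hz
    rw [← hF] at hode
    simp only [Real.rpow_sub hx, Real.rpow_one]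
    set T := D x ^ ((-1 : ℝ) / 8)
    set F₀ := F (Z x)
    set F₁ := deriv F (Z x)
    set F₂ := deriv (deriv F) (Z x)
    have c2 : x * D x ^ 2 * (N x / D x ^ 4) ^ 2 = 108 * (x - 1) ^ 2 * (Z x * (1 - Z x)) := by
      simp only [hZ, hN]
      field_simp
      simp only [hD]
      ring
    have c1 : x * D x ^ 2 * ((N' x * D x - 4 * N x * (2 * x + 14)) / D x ^ 5) +
        (3 / 4 * D x ^ 2 + x * (x + 7) * D x / 2) * (N x / D x ^ 4) =
        108 * (x - 1) ^ 2 * (3 / 4 - (7 / 24 + -1 / 24 + 1) * Z x) := by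
      simp only [hZ, hN, hN']
      field_simp
      simp only [hD]
      ring
    have c0 : x * D x ^ 2 * (2 * ((-1 : ℝ) / 8) * (T / D x) + (2 * x + 14) * ((-1 : ℝ) / 8) *
          ((2 * x + 14) * ((-1 : ℝ) / 8 - 1) * (T / D x / D x))) +
        (3 / 4 * D x ^ 2 + x * (x + 7) * D x / 2) *
          ((2 * x + 14) * ((-1 : ℝ) / 8) * (T / D x)) + 21 / 16 * (x - 1) ^ 2 * T = 0 := by
      field_simp
      simp only [hD]
      ring
    linear_combination 108 * (x - 1) ^ 2 * hode + F₂ * c2 + F₁ * c1 - c0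
end

section
/- There exists ε > 0 such that for all real x with |x| < ε, F(7/24, 23/24; 7/4; 108·x·(x-1)^4 / (x^2+14x+1)^3) = ((1 + 2x - x^2/11) / (1-x)^3) · (1+14x+x^2)^(7/8). -/
open Real

open Filter Topology

lemma summable_add_pow_mul_geometric (m k : ℕ) {r : ℝ} (hr0 : 0 < r) (hr : r < 1) :
    Summable fun n : ℕ => ((n : ℝ) + m) ^ k * r ^ n := by
  have h := (summable_nat_add_iff m).2
    (summable_pow_mul_geometric_of_norm_lt_one k (r := r) (by rwa [norm_of_nonneg hr0.le]))
  refine (h.mul_right (r ^ m)⁻¹).congr fun n => ?_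
  have : r ^ m ≠ 0 := by positivity
  push_cast
  field_simp
  ring

lemma summable_mul_pow_of_le_add_pow {α : ℕ → ℝ} {m k : ℕ}
    (hα : ∀ n : ℕ, |α n| ≤ ((n : ℝ) + m) ^ k) {z : ℝ} (hz : |z| < 1) :
    Summable fun n => α n * z ^ n := by
  obtain ⟨r, hzr, hr⟩ := exists_between hz
  have hr0 : 0 < r := (abs_nonneg z).trans_lt hzr
  refine .of_norm_bounded (summable_add_pow_mul_geometric m k hr0 hr) fun n => ?_
  rw [norm_mul, norm_pow, Real.norm_eq_abs, Real.norm_eq_abs]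
  gcongr
  exact hα n

/-- Termwise differentiation of a power series with coefficients of polynomial growth. -/
lemma hasDerivAt_tsum_mul_pow {α : ℕ → ℝ} {m k : ℕ}
    (hα : ∀ n : ℕ, |α n| ≤ ((n : ℝ) + m) ^ k) {z : ℝ} (hz : |z| < 1) :
    HasDerivAt (fun z => ∑' n, α n * z ^ n) (∑' n : ℕ, ((n : ℝ) + 1) * α (n + 1) * z ^ n) z := by
  obtain ⟨r, hzr, hr⟩ := exists_between hz
  have hr0 : 0 < r := (abs_nonneg z).trans_lt hzr
  have hu : Summable fun n : ℕ => ((n : ℝ) + m) ^ k * (n * r ^ (n - 1)) := by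
    rw [← summable_nat_add_iff 1]
    refine .of_nonneg_of_le (fun n => by positivity) (fun n => ?_)
      (summable_add_pow_mul_geometric (m + 1) (k + 1) hr0 hr)
    push_cast
    rw [← mul_assoc, pow_succ, add_right_comm, ← add_assoc]
    gcongr
    linarith [(Nat.cast_nonneg m : (0 : ℝ) ≤ m)]
  have hbound : ∀ (n : ℕ) (y : ℝ), y ∈ Metric.ball (0 : ℝ) r →
      ‖α n * (n * y ^ (n - 1))‖ ≤ ((n : ℝ) + m) ^ k * (n * r ^ (n - 1)) := by
    intro n y hy
    have hy' : |y| ≤ r := by simpa using (Metric.mem_ball.1 hy).le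
    rw [norm_mul, norm_mul, norm_pow, Real.norm_eq_abs, Real.norm_eq_abs, Real.norm_eq_abs,
      Nat.abs_cast]
    gcongr
    exact hα n
  have hmem : z ∈ Metric.ball (0 : ℝ) r := by simpa using hzr
  have h := hasDerivAt_tsum_of_isPreconnected hu Metric.isOpen_ball
    (convex_ball (0 : ℝ) r).isPreconnected
    (fun n y _ => (hasDerivAt_pow n y).const_mul (α n)) hbound hmem
    (summable_mul_pow_of_le_add_pow hα hz) hmem
  convert! h using 1
  rw [(Summable.of_norm_bounded hu fun n => hbound n z hmem).tsum_eq_zero_add]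
  simp only [Nat.cast_zero, zero_mul, mul_zero, zero_add]
  refine tsum_congr fun n => ?_
  push_cast
  ring

/-- The coefficients of the Gauss hypergeometric series. -/
noncomputable def hypgeoCoeff (a b c : ℝ) (n : ℕ) : ℝ :=
  (∏ i ∈ Finset.range n, (a + i)) * (∏ i ∈ Finset.range n, (b + i)) /
    ((∏ i ∈ Finset.range n, (c + i)) * (Nat.factorial n))

lemma hypgeoCoeff_succ {a b c : ℝ} (hc : 0 < c) (n : ℕ) :
    (n + 1) * (c + n) * hypgeoCoeff a b c (n + 1) = (a + n) * (b + n) * hypgeoCoeff a b c n := by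
  have h1 : 0 < ∏ i ∈ Finset.range n, (c + i) := Finset.prod_pos fun i _ => by positivity
  have h2 : 0 < c + n := by positivity
  simp only [hypgeoCoeff, Finset.prod_range_succ, Nat.factorial_succ]
  push_cast
  field_simp

lemma abs_hypgeoCoeff_le_one {a b c : ℝ} (ha : 0 < a) (hb : 0 < b) (hc : 0 < c)
    (h : ∀ n : ℕ, (a + n) * (b + n) ≤ (n + 1) * (c + n)) (n : ℕ) : |hypgeoCoeff a b c n| ≤ 1 := by
  induction n with
  | zero => simp [hypgeoCoeff]
  | succ n ih =>
    have hp : 0 < ((n : ℝ) + 1) * (c + n) := by positivity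
    have hq : 0 < (a + n) * (b + n) := by positivity
    have := congrArg abs (hypgeoCoeff_succ (a := a) (b := b) hc n)
    rw [abs_mul, abs_mul _ (hypgeoCoeff a b c n), abs_of_pos hp, abs_of_pos hq] at this
    have h3 := h n
    by_contra! hlt
    nlinarith [abs_nonneg (hypgeoCoeff a b c n)]

/-- The hypergeometric function together with its first two derivatives, satisfying the
hypergeometric differential equation. -/
lemma hypgeo_differential_equation {a b c : ℝ} (ha : 0 < a) (hb : 0 < b) (hc : 0 < c)
    (h : ∀ n : ℕ, (a + n) * (b + n) ≤ (n + 1) * (c + n)) :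
    AnalyticAt ℝ (hypgeo a b c) 0 ∧ ∃ F₁ F₂ : ℝ → ℝ, ∀ z : ℝ, |z| < 1 →
      HasDerivAt (hypgeo a b c) (F₁ z) z ∧ HasDerivAt F₁ (F₂ z) z ∧
      z * (1 - z) * F₂ z + (c - (a + b + 1) * z) * F₁ z - a * b * hypgeo a b c z = 0 := by
  set α := hypgeoCoeff a b c with hα
  have hF : hypgeo a b c = fun z => ∑' n, α n * z ^ n := rfl
  have h0 : ∀ n, |α n| ≤ 1 := abs_hypgeoCoeff_le_one ha hb hc h
  have hb0 : ∀ n : ℕ, |α n| ≤ ((n : ℝ) + (1 : ℕ)) ^ 0 := by simpa using h0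
  have hb1 : ∀ n : ℕ, |((n : ℝ) + 1) * α (n + 1)| ≤ ((n : ℝ) + (1 : ℕ)) ^ 1 := by
    intro n
    have hn : (0 : ℝ) ≤ n + 1 := by positivity
    rw [abs_mul, abs_of_nonneg hn]
    push_cast
    nlinarith [h0 (n + 1)]
  have hb2 : ∀ n : ℕ, |((n : ℝ) + 1) * (((n + 1 : ℕ) + 1) * α (n + 1 + 1))| ≤
      ((n : ℝ) + (2 : ℕ)) ^ 2 := by
    intro n
    have hn : (0 : ℝ) ≤ (n + 1) * (n + 1 + 1) := by positivity
    rw [← mul_assoc]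
    push_cast
    rw [abs_mul, abs_of_nonneg hn]
    have := mul_le_mul_of_nonneg_left (h0 (n + 1 + 1)) hn
    nlinarith [(Nat.cast_nonneg n : (0 : ℝ) ≤ n)]
  refine ⟨?_, fun z => ∑' n : ℕ, ((n : ℝ) + 1) * α (n + 1) * z ^ n,
    fun z => ∑' n : ℕ, ((n : ℝ) + 1) * (((n + 1 : ℕ) + 1) * α (n + 1 + 1)) * z ^ n,
    fun z hz => ⟨hasDerivAt_tsum_mul_pow hb0 hz, hasDerivAt_tsum_mul_pow hb1 hz, ?_⟩⟩
  · have hr : (1 : NNReal) ≤ (FormalMultilinearSeries.ofScalars ℝ α).radius :=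
      FormalMultilinearSeries.le_radius_of_bound _ 1 fun n => by
        simpa [FormalMultilinearSeries.ofScalars_norm] using h0 n
    have := ((FormalMultilinearSeries.ofScalars ℝ α).hasFPowerSeriesOnBall
      (lt_of_lt_of_le (by simp) hr)).analyticAt
    convert! this using 1
    rw [hF]
    ext z
    exact tsum_congr fun n => by
      rw [FormalMultilinearSeries.ofScalars_apply_eq, smul_eq_mul]
  · have s0 := (summable_mul_pow_of_le_add_pow hb0 hz).hasSum
    have s1 := (summable_mul_pow_of_le_add_pow hb1 hz).hasSum
    have s2 := (summable_mul_pow_of_le_add_pow hb2 hz).hasSum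
    set A := ∑' n, α n * z ^ n
    set B := ∑' n : ℕ, ((n : ℝ) + 1) * α (n + 1) * z ^ n
    set C := ∑' n : ℕ, ((n : ℝ) + 1) * (((n + 1 : ℕ) + 1) * α (n + 1 + 1)) * z ^ n
    have t1 : HasSum (fun n : ℕ => (n : ℝ) * α n * z ^ n) (z * B) := by
      rw [← hasSum_nat_add_iff' 1]
      simp only [Finset.range_one, Finset.sum_singleton, Nat.cast_zero, zero_mul, sub_zero]
      convert! s1.mul_left z using 2 with n
      push_cast
      ring
    have t2 : HasSum (fun n : ℕ => (n : ℝ) * ((n + 1) * α (n + 1)) * z ^ n) (z * C) := by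
      rw [← hasSum_nat_add_iff' 1]
      simp only [Finset.range_one, Finset.sum_singleton, Nat.cast_zero, zero_mul, sub_zero]
      convert! s2.mul_left z using 2 with n
      push_cast
      ring
    have t3 : HasSum (fun n : ℕ => (n : ℝ) * (n - 1) * α n * z ^ n) (z * (z * C)) := by
      rw [← hasSum_nat_add_iff' 1]
      simp only [Finset.range_one, Finset.sum_singleton, Nat.cast_zero, zero_mul, sub_zero]
      convert! t2.mul_left z using 2 with n
      push_cast
      ring
    have key := (((t2.sub t3).add (s1.mul_left c)).sub (t1.mul_left (a + b + 1))).sub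
      (s0.mul_left (a * b))
    have hzero : HasSum (fun _ : ℕ => (0 : ℝ)) 0 := hasSum_zero
    have := key.unique (by
      convert! hzero using 2 with n
      linear_combination z ^ n * hypgeoCoeff_succ (a := a) (b := b) hc n)
    rw [hF]
    linear_combination this

/-- An analytic solution of a second order linear equation with a regular singular point at `0`,
whose indicial equation `n * (n - 1) + n * q 0 = 0` has no positive integral root, vanishes
identically if it vanishes at `0`. -/
lemma eventually_eq_zero_of_regular_singular {D D₁ D₂ q r : ℝ → ℝ} (hD : AnalyticAt ℝ D 0)
    (hD0 : D 0 = 0) (h1 : ∀ᶠ x in 𝓝 0, HasDerivAt D (D₁ x) x)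
    (h2 : ∀ᶠ x in 𝓝 0, HasDerivAt D₁ (D₂ x) x) (hq : ContinuousAt q 0) (hr : ContinuousAt r 0)
    (hq0 : 0 < q 0) (hode : ∀ᶠ x in 𝓝 0, x * D₂ x + q x * D₁ x + r x * D x = 0) :
    ∀ᶠ x in 𝓝 0, D x = 0 := by
  by_contra hne
  obtain ⟨n, g, hg, hg0, hDg⟩ := hD.exists_eventuallyEq_pow_smul_nonzero_iff.2 hne
  simp only [sub_zero, smul_eq_mul] at hDg
  obtain ⟨m, rfl⟩ : ∃ m, n = m + 1 := by
    refine Nat.exists_eq_succ_of_ne_zero ?_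
    rintro rfl
    have := hDg.self_of_nhds
    rw [hD0, pow_zero, one_mul] at this
    exact hg0 this.symm
  have hg1 : ∀ᶠ x in 𝓝 0, HasDerivAt g (deriv g x) x :=
    hg.eventually_analyticAt.mono fun x hx => hx.differentiableAt.hasDerivAt
  have hg2 : ∀ᶠ x in 𝓝 0, HasDerivAt (deriv g) (deriv (deriv g) x) x :=
    hg.deriv.eventually_analyticAt.mono fun x hx => hx.differentiableAt.hasDerivAt
  have e1 : ∀ᶠ x in 𝓝 0, D₁ x = (m + 1) * x ^ m * g x + x ^ (m + 1) * deriv g x := by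
    filter_upwards [hDg.eventually_nhds, hg1, h1] with x hx hgx hDx
    have := (hasDerivAt_pow (m + 1) x).mul hgx
    simpa using hDx.unique (this.congr_of_eventuallyEq hx)
  have e2 : ∀ᶠ x in 𝓝 0, x * D₂ x = x ^ m * (m * (m + 1) * g x + 2 * (m + 1) * x * deriv g x +
      x ^ 2 * deriv (deriv g) x) := by
    filter_upwards [e1.eventually_nhds, hg1, hg2, h2] with x hx hgx hgx' hDx
    have := ((((hasDerivAt_pow m x).const_mul ((m : ℝ) + 1)).mul hgx).add
      ((hasDerivAt_pow (m + 1) x).mul hgx'))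
    rw [hDx.unique (this.congr_of_eventuallyEq hx)]
    rcases m with _ | m
    · simp
      ring
    · simp only [Nat.add_sub_cancel]
      push_cast
      ring
  set Φ : ℝ → ℝ := fun x => m * (m + 1) * g x + 2 * (m + 1) * x * deriv g x +
      x ^ 2 * deriv (deriv g) x + q x * ((m + 1) * g x + x * deriv g x) + r x * (x * g x) with hΦ
  have hΦ0 : ∀ᶠ x in 𝓝[≠] 0, Φ x = 0 := by
    filter_upwards [hode.filter_mono nhdsWithin_le_nhds, e1.filter_mono nhdsWithin_le_nhds,
      e2.filter_mono nhdsWithin_le_nhds, hDg.filter_mono nhdsWithin_le_nhds,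
      self_mem_nhdsWithin] with x ho hx1 hx2 hx0 hx
    have : x ^ m * Φ x = 0 := by
      rw [hx2, hx1, hx0] at ho
      rw [hΦ]
      linear_combination ho
    exact (mul_eq_zero.1 this).resolve_left (pow_ne_zero m hx)
  have hcont : ContinuousAt Φ 0 := by
    have c0 := hg.continuousAt
    have c1 := hg.deriv.continuousAt
    have c2 := hg.deriv.deriv.continuousAt
    fun_prop
  have hlim : Φ 0 = 0 := tendsto_nhds_unique (hcont.tendsto.mono_left nhdsWithin_le_nhds)
    (tendsto_const_nhds.congr' (hΦ0.mono fun x hx => hx.symm))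
  have : (m + 1) * (m + q 0) * g 0 = 0 := by
    linear_combination hlim
  have hpos : ((m : ℝ) + 1) * (m + q 0) ≠ 0 := by positivity
  exact (mul_ne_zero hpos hg0) this

lemma hasDerivAt_mul_rpow {f : ℝ → ℝ} {f' x : ℝ} (s : ℝ) (hf : HasDerivAt f f' x)
    (hS : 0 < 1 + 14 * x + x ^ 2) :
    HasDerivAt (fun x => f x * (1 + 14 * x + x ^ 2) ^ s)
      ((f' + s * (14 + 2 * x) / (1 + 14 * x + x ^ 2) * f x) * (1 + 14 * x + x ^ 2) ^ s) x := by
  have h1 : HasDerivAt (fun x : ℝ => 1 + 14 * x + x ^ 2) (14 + 2 * x) x := by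
    convert! (((hasDerivAt_id' x).const_mul 14).const_add 1).add (hasDerivAt_pow 2 x) using 1
    push_cast
    ring
  convert! hf.mul (h1.rpow_const (p := s) (Or.inl hS.ne')) using 1
  rw [rpow_sub_one hS.ne']
  field_simp

theorem stmt8 : ∃ ε > 0, ∀ x : ℝ, |x| < ε →
    hypgeo (7/24) (23/24) (7/4) (108 * x * (x - 1)^4 / (x^2 + 14*x + 1)^3) =
      ((1 + 2*x - x^2/11) / (1 - x)^3) * (1 + 14*x + x^2) ^ ((7 : ℝ)/8) := by
  suffices h : ∀ᶠ x : ℝ in 𝓝 0,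
      hypgeo (7/24) (23/24) (7/4) (108 * x * (x - 1)^4 / (x^2 + 14*x + 1)^3) -
      ((1 + 2*x - x^2/11) / (1 - x)^3) * (1 + 14*x + x^2) ^ ((7 : ℝ)/8) = 0 by
    obtain ⟨ε, hε, h⟩ := Metric.eventually_nhds_iff.1 h
    exact ⟨ε, hε, fun x hx => sub_eq_zero.1 (h (by simpa using hx))⟩
  obtain ⟨hFan, F₁, F₂, hF⟩ := hypgeo_differential_equation (a := 7/24) (b := 23/24) (c := 7/4)
    (by norm_num) (by norm_num) (by norm_num) (fun n => by
      nlinarith [(Nat.cast_nonneg n : (0 : ℝ) ≤ n)])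
  have hS : ∀ᶠ x : ℝ in 𝓝 0, 0 < 1 + 14 * x + x ^ 2 :=
    (show ContinuousAt (fun x : ℝ => 1 + 14 * x + x ^ 2) 0 by fun_prop).eventually
      (lt_mem_nhds (by norm_num))
  have hx1 : ∀ᶠ x : ℝ in 𝓝 0, 0 < 1 - x :=
    (show ContinuousAt (fun x : ℝ => 1 - x) 0 by fun_prop).eventually
      (lt_mem_nhds (by norm_num))
  have hzan : AnalyticAt ℝ (fun x : ℝ => 108 * x * (x - 1)^4 / (x^2 + 14*x + 1)^3) 0 := by
    fun_prop (disch := norm_num)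
  have hz : ∀ᶠ x : ℝ in 𝓝 0, |108 * x * (x - 1)^4 / (x^2 + 14*x + 1)^3| < 1 :=
    hzan.continuousAt.abs.eventually_lt_const (by norm_num)
  have hS' : ∀ x : ℝ, HasDerivAt (fun x : ℝ => 1 + 14 * x + x ^ 2) (14 + 2 * x) x := fun x => by
    convert! (((hasDerivAt_id' x).const_mul 14).const_add 1).add (hasDerivAt_pow 2 x) using 1
    push_cast
    ring
  set ζ : ℝ → ℝ := fun x => 108 * x * (x - 1)^4 / (x^2 + 14*x + 1)^3 with hζ
  set ζ₁ : ℝ → ℝ := fun x =>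
    -108 * (x - 1) ^ 3 * (x ^ 3 - 33 * x ^ 2 - 33 * x + 1) / (1 + 14 * x + x ^ 2) ^ 4 with hζ₁
  set ζ₂ : ℝ → ℝ := fun x =>
    -108 * (x - 1) ^ 2 * ((3 * (x ^ 3 - 33 * x ^ 2 - 33 * x + 1) +
      (x - 1) * (3 * x ^ 2 - 66 * x - 33)) * (1 + 14 * x + x ^ 2) -
      4 * (x - 1) * (x ^ 3 - 33 * x ^ 2 - 33 * x + 1) * (14 + 2 * x)) /
      (1 + 14 * x + x ^ 2) ^ 5 with hζ₂
  have hz1 : ∀ x : ℝ, 0 < 1 + 14 * x + x ^ 2 → HasDerivAt ζ (ζ₁ x) x := by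
    intro x hx
    have hζ' : ζ = fun x => 108 * x * (x - 1)^4 / (1 + 14 * x + x ^ 2)^3 := by
      ext y
      rw [hζ]
      ring_nf
    rw [hζ']
    convert! (((hasDerivAt_id' x).const_mul 108).mul (((hasDerivAt_id' x).sub_const 1).pow 4)).div
      ((hS' x).pow 3) (pow_ne_zero 3 hx.ne') using 1
    simp only [hζ₁, Pi.pow_apply, Pi.mul_apply]
    push_cast
    field_simp
    ring
  have hz2 : ∀ x : ℝ, 0 < 1 + 14 * x + x ^ 2 → HasDerivAt ζ₁ (ζ₂ x) x := by
    intro x hx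
    have hK : HasDerivAt (fun x : ℝ => x ^ 3 - 33 * x ^ 2 - 33 * x + 1)
        (3 * x ^ 2 - 66 * x - 33) x := by
      convert! ((((hasDerivAt_pow 3 x).sub ((hasDerivAt_pow 2 x).const_mul 33)).sub
        ((hasDerivAt_id' x).const_mul 33)).add_const 1) using 1
      push_cast
      ring
    convert! (((((hasDerivAt_id' x).sub_const 1).pow 3).const_mul (-108)).mul hK).div
      ((hS' x).pow 4) (pow_ne_zero 4 hx.ne') using 1
    simp only [hζ₂, Pi.pow_apply, Pi.mul_apply]
    push_cast
    field_simp
    ring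
  have h1x : ∀ x : ℝ, HasDerivAt (fun x : ℝ => 1 - x) (-1) x := fun x =>
    (hasDerivAt_id' x).const_sub 1
  set R : ℝ → ℝ := fun x => (1 + 2*x - x^2/11) / (1 - x)^3 with hR
  set R₁ : ℝ → ℝ := fun x =>
    (5 + 42 / 11 * x - x ^ 2 / 11) / (1 - x) ^ 4 +
      7 / 8 * (14 + 2 * x) / (1 + 14 * x + x ^ 2) * R x with hR₁
  set R₂ : ℝ → ℝ := fun x =>
    (((42 / 11 - 2 * x / 11) * (1 - x) + 4 * (5 + 42 / 11 * x - x ^ 2 / 11)) / (1 - x) ^ 5 +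
      (7 / 8 * (2 / (1 + 14 * x + x ^ 2) - (14 + 2 * x) ^ 2 / (1 + 14 * x + x ^ 2) ^ 2) * R x +
        7 / 8 * (14 + 2 * x) / (1 + 14 * x + x ^ 2) *
          ((5 + 42 / 11 * x - x ^ 2 / 11) / (1 - x) ^ 4))) +
      7 / 8 * (14 + 2 * x) / (1 + 14 * x + x ^ 2) * R₁ x with hR₂
  have hR1 : ∀ x : ℝ, 0 < 1 - x →
      HasDerivAt R ((5 + 42 / 11 * x - x ^ 2 / 11) / (1 - x) ^ 4) x := by
    intro x hx
    convert! ((((hasDerivAt_id' x).const_mul 2).const_add 1).sub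
      ((hasDerivAt_pow 2 x).div_const 11)).div ((h1x x).pow 3) (pow_ne_zero 3 hx.ne') using 1
    simp only [Pi.pow_apply, Pi.sub_apply]
    push_cast
    field_simp
    ring
  have hR2 : ∀ x : ℝ, 0 < 1 - x → 0 < 1 + 14 * x + x ^ 2 →
      HasDerivAt R₁ (R₂ x - 7 / 8 * (14 + 2 * x) / (1 + 14 * x + x ^ 2) * R₁ x) x := by
    intro x hx hx'
    have hT : HasDerivAt (fun x : ℝ => 7 / 8 * (14 + 2 * x) / (1 + 14 * x + x ^ 2))
        (7 / 8 * (2 / (1 + 14 * x + x ^ 2) - (14 + 2 * x) ^ 2 / (1 + 14 * x + x ^ 2) ^ 2)) x := by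
      convert! ((((hasDerivAt_id' x).const_mul 2).const_add 14).const_mul (7 / 8)).div (hS' x)
        hx'.ne' using 1
      field_simp
    have hN : HasDerivAt (fun x : ℝ => (5 + 42 / 11 * x - x ^ 2 / 11) / (1 - x) ^ 4)
        (((42 / 11 - 2 * x / 11) * (1 - x) + 4 * (5 + 42 / 11 * x - x ^ 2 / 11)) /
          (1 - x) ^ 5) x := by
      convert! ((((hasDerivAt_id' x).const_mul (42 / 11)).const_add 5).sub
        ((hasDerivAt_pow 2 x).div_const 11)).div ((h1x x).pow 4) (pow_ne_zero 4 hx.ne') using 1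
      simp only [Pi.pow_apply, Pi.sub_apply]
      push_cast
      field_simp
      ring
    convert! hN.add (hT.mul (hR1 x hx)) using 1
    simp only [hR₂]
    ring
  refine eventually_eq_zero_of_regular_singular
    (D₁ := fun x => F₁ (ζ x) * ζ₁ x - R₁ x * (1 + 14*x + x^2) ^ ((7 : ℝ)/8))
    (D₂ := fun x => F₂ (ζ x) * ζ₁ x * ζ₁ x + F₁ (ζ x) * ζ₂ x -
      R₂ x * (1 + 14*x + x^2) ^ ((7 : ℝ)/8))
    (q := fun x => 7 / 4 - 4 * x / (1 - x) - 11 / 4 * x * (14 + 2 * x) / (1 + 14 * x + x ^ 2))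
    (r := fun x => -(483 / 16) * (1 - x) ^ 2 / (1 + 14 * x + x ^ 2) ^ 2) ?_ ?_ ?_ ?_ ?_ ?_ ?_ ?_
  · have hrpow : AnalyticAt ℝ (fun x : ℝ => (1 + 14 * x + x ^ 2) ^ ((7 : ℝ) / 8)) 0 :=
      ((show AnalyticAt ℝ (fun x : ℝ => 1 + 14 * x + x ^ 2) 0 by fun_prop).contDiffAt
        (n := ⊤) |>.rpow_const_of_ne (by norm_num)).analyticAt
    refine AnalyticAt.sub (AnalyticAt.fun_comp ?_ hzan) (.mul ?_ hrpow)
    · simpa [hζ] using hFan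
    · fun_prop (disch := norm_num)
  · rw [hypgeo, tsum_eq_single 0 (fun n hn => by simp [hn])]
    simp
  · filter_upwards [hS, hx1, hz] with x hSx hx hzx
    exact ((hF _ hzx).1.comp x (hz1 x hSx)).sub (hasDerivAt_mul_rpow _ (hR1 x hx) hSx)
  · filter_upwards [hS, hx1, hz] with x hSx hx hzx
    convert! (((hF _ hzx).2.1.comp x (hz1 x hSx)).mul (hz2 x hSx)).sub
      (hasDerivAt_mul_rpow (7 / 8) (hR2 x hx hSx) hSx) using 1
    simp only [Function.comp_apply]
    ring
  · fun_prop (disch := norm_num)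
  · fun_prop (disch := norm_num)
  · norm_num
  · filter_upwards [hS, hx1, hz] with x hSx hx hzx
    have e1 : x * ζ₁ x ^ 2 = 108 * (1 - x) ^ 2 / (1 + 14 * x + x ^ 2) ^ 2 *
        (ζ x * (1 - ζ x)) := by
      simp only [hζ, hζ₁]
      rw [show x ^ 2 + 14 * x + 1 = 1 + 14 * x + x ^ 2 by ring]
      generalize hSe : 1 + 14 * x + x ^ 2 = S at hSx ⊢
      field_simp
      subst hSe
      ring
    have e2 : x * ζ₂ x + (7 / 4 - 4 * x / (1 - x) -
        11 / 4 * x * (14 + 2 * x) / (1 + 14 * x + x ^ 2)) * ζ₁ x =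
        108 * (1 - x) ^ 2 / (1 + 14 * x + x ^ 2) ^ 2 * (7 / 4 - 9 / 4 * ζ x) := by
      simp only [hζ, hζ₁, hζ₂]
      rw [show x ^ 2 + 14 * x + 1 = 1 + 14 * x + x ^ 2 by ring]
      generalize hSe : 1 + 14 * x + x ^ 2 = S at hSx ⊢
      field_simp
      subst hSe
      ring
    have e3 : x * R₂ x + (7 / 4 - 4 * x / (1 - x) -
        11 / 4 * x * (14 + 2 * x) / (1 + 14 * x + x ^ 2)) * R₁ x +
        -(483 / 16) * (1 - x) ^ 2 / (1 + 14 * x + x ^ 2) ^ 2 * R x = 0 := by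
      simp only [hR₂, hR₁, hR]
      generalize hSe : 1 + 14 * x + x ^ 2 = S at hSx ⊢
      field_simp
      subst hSe
      ring
    have e4 := (hF _ hzx).2.2
    linear_combination F₂ (ζ x) * e1 + F₁ (ζ x) * e2 -
      (1 + 14*x + x^2) ^ ((7 : ℝ)/8) * e3 +
      108 * (1 - x) ^ 2 / (1 + 14 * x + x ^ 2) ^ 2 * e4
end

section
/- There exists ε > 0 such that for all real x with |x| < ε, F(7/12, -1/12; 3/4; 27·x·(x+1)^4 / (2(x^2+4x+1)^3)) = (1 + x/2)^(1/4) / (1+4x+x^2)^(1/4). -/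
open Real

open Filter Topology

/-- The `n`-th Taylor coefficient of `f` at the origin. -/
noncomputable def taylorCoeffZero (f : ℝ → ℝ) (n : ℕ) : ℝ :=
  iteratedDeriv n f 0 / n.factorial

theorem taylorCoeffZero_deriv (f : ℝ → ℝ) (n : ℕ) :
    taylorCoeffZero (deriv f) n = (n + 1) * taylorCoeffZero f (n + 1) := by
  unfold taylorCoeffZero
  rw [← iteratedDeriv_succ', Nat.factorial_succ]
  push_cast
  field_simp

theorem AnalyticAt.eventually_hasSum_taylorCoeffZero {f : ℝ → ℝ} (hf : AnalyticAt ℝ f 0) :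
    ∀ᶠ z in 𝓝 (0 : ℝ), HasSum (fun n => taylorCoeffZero f n * z ^ n) (f z) := by
  have h := hasFPowerSeriesAt_iff.mp hf.hasFPowerSeriesAt
  filter_upwards [h] with z hz
  simpa [taylorCoeffZero, FormalMultilinearSeries.coeff_ofScalars, mul_comm] using hz

theorem eq_zero_of_eventually_hasSum_zero {u : ℕ → ℝ}
    (h : ∀ᶠ z in 𝓝 (0 : ℝ), HasSum (fun n => u n * z ^ n) 0) (n : ℕ) : u n = 0 := by
  have h' : HasFPowerSeriesAt (fun _ : ℝ => (0 : ℝ))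
      (FormalMultilinearSeries.ofScalars ℝ u) 0 := by
    rw [hasFPowerSeriesAt_iff]
    filter_upwards [h] with z hz
    simpa [FormalMultilinearSeries.coeff_ofScalars, mul_comm] using hz
  have hn := congrArg (fun p => FormalMultilinearSeries.coeff p n) h'.eq_zero
  simp only [FormalMultilinearSeries.coeff_ofScalars] at hn
  simpa [FormalMultilinearSeries.coeff] using hn

theorem hasSum_mul_shift {u : ℕ → ℝ} {z s : ℝ} (h : HasSum (fun n => u n * z ^ n) s) :
    HasSum (fun n => (if n = 0 then 0 else u (n - 1)) * z ^ n) (z * s) := by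
  rw [← hasSum_nat_add_iff' 1]
  simpa [pow_succ, mul_comm, mul_left_comm, mul_assoc] using h.mul_left z

theorem taylorCoeffZero_succ_of_hypergeometric_ode {a b c : ℝ} {G : ℝ → ℝ}
    (hG : AnalyticAt ℝ G 0)
    (hode : ∀ᶠ z in 𝓝 (0 : ℝ), z * (1 - z) * deriv (deriv G) z
      + (c - (a + b + 1) * z) * deriv G z - a * b * G z = 0) (n : ℕ) :
    (n + 1) * (c + n) * taylorCoeffZero G (n + 1) = (a + n) * (b + n) * taylorCoeffZero G n := by
  have h : ∀ᶠ z in 𝓝 (0 : ℝ), HasSum (fun n : ℕ =>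
      ((n + 1) * (c + n) * taylorCoeffZero G (n + 1)
        - (a + n) * (b + n) * taylorCoeffZero G n) * z ^ n) 0 := by
    filter_upwards [hode, hG.eventually_hasSum_taylorCoeffZero,
      hG.deriv.eventually_hasSum_taylorCoeffZero,
      hG.deriv.deriv.eventually_hasSum_taylorCoeffZero] with z hz h0 h1 h2
    have s1 := hasSum_mul_shift h1
    have s2 := hasSum_mul_shift h2
    have s3 := hasSum_mul_shift s2
    have hs := (((s2.sub s3).add (h1.mul_left c)).sub (s1.mul_left (a + b + 1))).sub
      (h0.mul_left (a * b))
    convert! hs using 1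
    · funext k
      rcases k with _ | _ | k
      · simp [taylorCoeffZero_deriv]
      · simp [taylorCoeffZero_deriv]; ring
      · simp [taylorCoeffZero_deriv]; ring
    · linear_combination -hz
  linear_combination eq_zero_of_eventually_hasSum_zero h n

/-- An analytic solution of the hypergeometric equation at the origin is a multiple of the
hypergeometric series. -/
theorem eventually_hypgeo_mul_eq_of_ode {a b c : ℝ} {G : ℝ → ℝ} (hc : ∀ n : ℕ, c + n ≠ 0)
    (hG : AnalyticAt ℝ G 0)
    (hode : ∀ᶠ z in 𝓝 (0 : ℝ), z * (1 - z) * deriv (deriv G) z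
      + (c - (a + b + 1) * z) * deriv G z - a * b * G z = 0) :
    ∀ᶠ z in 𝓝 (0 : ℝ), hypgeo a b c z * G 0 = G z := by
  have hcoeff : ∀ n : ℕ, taylorCoeffZero G n =
      ((∏ i ∈ Finset.range n, (a + i)) * (∏ i ∈ Finset.range n, (b + i)) /
        ((∏ i ∈ Finset.range n, (c + i)) * (Nat.factorial n))) * G 0 := by
    intro n
    induction n with
    | zero => simp [taylorCoeffZero]
    | succ n ih =>
      have hrec := taylorCoeffZero_succ_of_hypergeometric_ode hG hode n
      have hn : (n : ℝ) + 1 ≠ 0 := by positivity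
      have hprod : ∏ i ∈ Finset.range n, (c + i) ≠ 0 :=
        Finset.prod_ne_zero_iff.mpr fun i _ => hc i
      have hcn := hc n
      rw [ih] at hrec
      rw [← mul_right_inj' (mul_ne_zero hn hcn), hrec]
      simp only [Finset.prod_range_succ, Nat.factorial_succ]
      push_cast
      field_simp
  filter_upwards [hG.eventually_hasSum_taylorCoeffZero] with z hz
  rw [← hz.tsum_eq, hypgeo, ← tsum_mul_right]
  exact tsum_congr fun n => by rw [hcoeff]; ring

/-- Differentiating a local factorization `G ∘ f = g`. -/
theorem eventually_deriv_comp_eq {f f' G g g' : ℝ → ℝ} {x₀ : ℝ}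
    (hf : ∀ᶠ x in 𝓝 x₀, HasDerivAt f (f' x) x) (hg : ∀ᶠ x in 𝓝 x₀, HasDerivAt g (g' x) x)
    (hf' : ∀ᶠ x in 𝓝 x₀, f' x ≠ 0) (hG : AnalyticAt ℝ G (f x₀))
    (hcomp : ∀ᶠ x in 𝓝 x₀, G (f x) = g x) :
    ∀ᶠ x in 𝓝 x₀, deriv G (f x) = g' x / f' x := by
  have hcont : ContinuousAt f x₀ := hf.self_of_nhds.continuousAt
  filter_upwards [hf, hg, hf', hcont.eventually hG.eventually_analyticAt,
    hcomp.eventually_nhds] with x hfx hgx hf'x hGx hcx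
  have hchain := hGx.differentiableAt.hasDerivAt.comp x hfx
  rw [eq_div_iff hf'x]
  exact hchain.unique (hgx.congr_of_eventuallyEq hcx)

/-- The rational argument of the degree six algebraic transformation. -/
noncomputable def sexticArg (x : ℝ) : ℝ := 27 * x * (x + 1)^4 / (2 * (x^2 + 4*x + 1)^3)

/-- The algebraic value of the hypergeometric function at `sexticArg x`. -/
noncomputable def sexticValue (x : ℝ) : ℝ :=
  (1 + x/2) ^ ((1 : ℝ)/4) / (1 + 4*x + x^2) ^ ((1 : ℝ)/4)

theorem hasDerivAt_sexticArg {x : ℝ} (hx : x^2 + 4*x + 1 ≠ 0) :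
    HasDerivAt sexticArg (27 * (x + 1)^3 * (1 - x)^3 / (2 * (x^2 + 4*x + 1)^4)) x := by
  have hid := hasDerivAt_id' x
  have hT := ((hid.pow 2).add (hid.const_mul 4)).add_const 1
  have h := ((hid.const_mul 27).mul ((hid.add_const 1).pow 4)).div ((hT.pow 3).const_mul 2)
    (by simpa using hx)
  convert! h using 1
  simp
  field_simp
  ring

theorem analyticAt_sexticArg_zero : AnalyticAt ℝ sexticArg 0 := by
  unfold sexticArg
  fun_prop (disch := norm_num)

theorem analyticAt_sexticValue_zero : AnalyticAt ℝ sexticValue 0 := by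
  unfold sexticValue
  exact ContDiffAt.analyticAt <| ContDiffAt.div (ContDiffAt.rpow_const_of_ne (by fun_prop) (by norm_num))
    (ContDiffAt.rpow_const_of_ne (by fun_prop) (by norm_num)) (by norm_num)

theorem hasDerivAt_sexticValue {x : ℝ} (h₁ : 0 < 1 + x/2) (h₂ : 0 < 1 + 4*x + x^2) :
    HasDerivAt sexticValue
      (sexticValue x * (-(x^2 + 4*x + 7) / (4 * (2 + x) * (x^2 + 4*x + 1)))) x := by
  have hid := hasDerivAt_id' x
  have hL := ((hid.div_const 2).const_add 1).rpow_const (p := (1 : ℝ)/4) (Or.inl h₁.ne')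
  have hT := (((hid.const_mul 4).const_add 1).add (hid.pow 2)).rpow_const (p := (1 : ℝ)/4)
    (Or.inl h₂.ne')
  convert! hL.div hT (rpow_pos_of_pos h₂ _).ne' using 1
  have h₂' : x^2 + 4*x + 1 ≠ 0 := by linarith
  have h₁' : 2 + x ≠ 0 := by linarith
  simp only [sexticValue, Pi.add_apply, Pi.pow_apply]
  rw [rpow_sub_one h₁.ne', rpow_sub_one h₂.ne']
  have hp := (rpow_pos_of_pos h₂ ((1 : ℝ)/4)).ne'
  generalize (1 + 4*x + x^2) ^ ((1 : ℝ)/4) = q at *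
  generalize (1 + x/2) ^ ((1 : ℝ)/4) = p at *
  rw [show 1 + 4*x + x^2 = x^2 + 4*x + 1 by ring, show 1 + x/2 = (2 + x)/2 by ring]
  generalize hS : x^2 + 4*x + 1 = S at h₂' ⊢
  field_simp
  subst hS
  ring

/-- The derivative of `sexticValue` with respect to `sexticArg`, divided by `sexticValue`. -/
noncomputable def sexticLogDeriv (x : ℝ) : ℝ :=
  -((x^2 + 4*x + 7) * (x^2 + 4*x + 1)^3) / (54 * (2 + x) * ((1 + x) * (1 - x))^3)

theorem hasDerivAt_sexticLogDeriv {x : ℝ} (h₁ : 2 + x ≠ 0) (h₂ : 1 + x ≠ 0) (h₃ : 1 - x ≠ 0) :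
    HasDerivAt sexticLogDeriv
      ((-((2*x + 4) * (x^2 + 4*x + 1)^3 +
          (x^2 + 4*x + 7) * (3 * (x^2 + 4*x + 1)^2 * (2*x + 4))) *
            ((2 + x) * (1 + x) * (1 - x)) +
        (x^2 + 4*x + 7) * (x^2 + 4*x + 1)^3 * ((1 + x) * (1 - x) - 6 * x * (2 + x))) /
        (54 * (2 + x)^2 * ((1 + x) * (1 - x))^4)) x := by
  have hid := hasDerivAt_id' x
  have hS := (hid.pow 2).add (hid.const_mul 4)
  have hnum := ((hS.add_const 7).mul ((hS.add_const 1).pow 3)).neg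
  have hden := ((hid.const_add 2).const_mul 54).mul
    (((hid.const_add 1).mul (hid.const_sub 1)).pow 3)
  convert! hnum.div hden (by simp [h₁, h₂, h₃]) using 1
  simp
  field_simp
  ring

theorem stmt11 : ∃ ε > 0, ∀ x : ℝ, |x| < ε →
    hypgeo (7/12) (-1/12) (3/4) (27 * x * (x + 1)^4 / (2 * (x^2 + 4*x + 1)^3)) =
      (1 + x/2) ^ ((1 : ℝ)/4) / (1 + 4*x + x^2) ^ ((1 : ℝ)/4) := by
  have hev₁ : ∀ᶠ x : ℝ in 𝓝 0, 0 < 1 + x/2 :=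
    ContinuousAt.eventually_lt (by fun_prop) (by fun_prop) (by norm_num)
  have hev₂ : ∀ᶠ x : ℝ in 𝓝 0, 0 < 1 + 4*x + x^2 :=
    ContinuousAt.eventually_lt (by fun_prop) (by fun_prop) (by norm_num)
  have hev₃ : ∀ᶠ x : ℝ in 𝓝 0, 0 < 1 + x :=
    ContinuousAt.eventually_lt (by fun_prop) (by fun_prop) (by norm_num)
  have hev₄ : ∀ᶠ x : ℝ in 𝓝 0, 0 < 1 - x :=
    ContinuousAt.eventually_lt (by fun_prop) (by fun_prop) (by norm_num)
  have harg₀ : sexticArg 0 = 0 := by simp [sexticArg]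
  have hvalue₀ : sexticValue 0 = 1 := by simp [sexticValue]
  have hne : deriv sexticArg 0 ≠ 0 := by
    rw [(hasDerivAt_sexticArg (by norm_num)).deriv]; norm_num
  have hstrict := analyticAt_sexticArg_zero.hasStrictDerivAt
  set φ := hstrict.localInverse _ _ _ hne
  have hφarg : ∀ᶠ x in 𝓝 0, φ (sexticArg x) = x :=
    HasStrictFDerivAt.eventually_left_inverse _
  set G : ℝ → ℝ := fun z => sexticValue (φ z) with hGdef
  have hcomp : ∀ᶠ x in 𝓝 0, G (sexticArg x) = sexticValue x := by
    filter_upwards [hφarg] with x hx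
    simp only [hGdef, hx]
  have hG : AnalyticAt ℝ G (sexticArg 0) := by
    rw [← analyticAt_comp_iff_of_deriv_ne_zero analyticAt_sexticArg_zero hne]
    exact analyticAt_sexticValue_zero.congr (hcomp.mono fun x hx => hx.symm)
  have hargDeriv : ∀ᶠ x in 𝓝 0, HasDerivAt sexticArg
      (27 * (x + 1)^3 * (1 - x)^3 / (2 * (x^2 + 4*x + 1)^4)) x := by
    filter_upwards [hev₂] with x h₂ using hasDerivAt_sexticArg (by linarith)
  have hargDeriv_ne : ∀ᶠ x : ℝ in 𝓝 0,
      27 * (x + 1)^3 * (1 - x)^3 / (2 * (x^2 + 4*x + 1)^4) ≠ 0 := by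
    filter_upwards [hev₂, hev₃, hev₄] with x h₂ h₃ h₄
    have h₂' : 0 < x^2 + 4*x + 1 := by linarith
    have h₃' : 0 < x + 1 := by linarith
    positivity
  have hvalueDeriv := (hev₁.and hev₂).mono fun x h => hasDerivAt_sexticValue h.1 h.2
  have hderiv : ∀ᶠ x in 𝓝 0, deriv G (sexticArg x) = sexticValue x * sexticLogDeriv x := by
    filter_upwards [eventually_deriv_comp_eq hargDeriv hvalueDeriv hargDeriv_ne hG hcomp,
      hev₁, hev₂, hev₃, hev₄] with x hx h₁ h₂ h₃ h₄
    rw [hx, sexticLogDeriv]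
    have h₁' : 2 + x ≠ 0 := by linarith
    have h₂' : x^2 + 4*x + 1 ≠ 0 := by linarith
    rw [add_comm x 1]
    field_simp
    ring
  have hderivDeriv := eventually_deriv_comp_eq hargDeriv
    ((hvalueDeriv.and (hev₁.and (hev₃.and hev₄))).mono fun x h =>
      h.1.mul (hasDerivAt_sexticLogDeriv (x := x) (by linarith [h.2.1]) h.2.2.1.ne' h.2.2.2.ne'))
    hargDeriv_ne hG.deriv hderiv
  have hode : ∀ᶠ z in 𝓝 (0 : ℝ), z * (1 - z) * deriv (deriv G) z
      + (3/4 - (7/12 + -1/12 + 1) * z) * deriv G z - 7/12 * (-1/12) * G z = 0 := by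
    have hmap := hstrict.map_nhds_eq hne
    rw [harg₀] at hmap
    rw [← hmap, eventually_map]
    filter_upwards [hcomp, hderiv, hderivDeriv, hev₁, hev₂, hev₃, hev₄]
      with x hx hx' hx'' h₁ h₂ h₃ h₄
    rw [hx, hx', hx'', sexticLogDeriv, sexticArg]
    have h₁' : 2 + x ≠ 0 := by linarith
    have h₂' : x^2 + 4*x + 1 ≠ 0 := by linarith
    rw [add_comm x 1]
    generalize sexticValue x = v
    generalize hT : x^2 + 4*x + 1 = T at h₂' ⊢
    field_simp
    subst hT
    ring
  rw [harg₀] at hG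
  have hmain := eventually_hypgeo_mul_eq_of_ode (c := 3/4) (fun n => by positivity) hG hode
  have hG₀ : G 0 = 1 := by rw [← harg₀, hcomp.self_of_nhds, hvalue₀]
  have hcont : Tendsto sexticArg (𝓝 0) (𝓝 0) := by
    simpa [harg₀] using analyticAt_sexticArg_zero.continuousAt.tendsto
  have hfinal := (hcont.eventually hmain).and hcomp
  obtain ⟨ε, hε, h⟩ := Metric.eventually_nhds_iff.mp hfinal
  refine ⟨ε, hε, fun x hx => ?_⟩
  obtain ⟨h₁, h₂⟩ := h (y := x) (by simpa using hx)
  rwa [hG₀, mul_one, h₂] at h₁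
end
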